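/- Let d ≥ 2 be an integer, Δ > 0, L ≥ 2 an even integer and ε ∈ (0, 1/(2d)]. Then the rectangular-envelope GKP code states Sha^ε_{L,Δ}(0)_d, …, Sha^ε_{L,Δ}(d−1)_d form an orthonormal family in L²(ℝ): ∫_ℝ Sha^ε_{L,Δ}(j)_d(x)·Sha^ε_{L,Δ}(k)_d(x) dx = δ_{j,k} for all j,k ∈ {0,…,d−1}. -/

import Mathlib

open MeasureTheory Real

/-- The unnormalized truncated Gaussian: `e^{−x²/(2Δ²)}` for `|x| ≤ ε` and `0` otherwise. -/
noncomputable def truncGauss (Δ ε : ℝ) (x : ℝ) : ℝ :=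
  if |x| ≤ ε then Real.exp (-x ^ 2 / (2 * Δ ^ 2)) else 0

/-- The normalized truncated Gaussian `Ψ^ε_Δ`, with unit `L²(ℝ)`-norm. -/
noncomputable def truncGaussNorm (Δ ε : ℝ) (x : ℝ) : ℝ :=
  truncGauss Δ ε x / Real.sqrt (∫ y : ℝ, truncGauss Δ ε y ^ 2)

/-- The rectangular-envelope GKP (comb) state
`Sha^ε_{L,Δ} = L^{−1/2}·Σ_{z=−L/2}^{L/2−1} Ψ^ε_Δ(· − z)`. -/
noncomputable def shaState (L : ℕ) (Δ ε : ℝ) (x : ℝ) : ℝ :=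
  (Real.sqrt L)⁻¹ *
    ∑ z ∈ Finset.Icc (-(L : ℤ) / 2) ((L : ℤ) / 2 - 1), truncGaussNorm Δ ε (x - z)

/-- The rectangular-envelope GKP code state
`Sha^ε_{L,Δ}(j)_d(x) = (2πd)^{−1/4}·Sha^ε_{L,Δ}((x − √(2π/d)·j)/√(2πd))`. -/
noncomputable def shaCode (d L : ℕ) (Δ ε : ℝ) (j : ℕ) (x : ℝ) : ℝ :=
  (2 * π * d) ^ (-(1 / 4 : ℝ)) *
    shaState L Δ ε ((x - Real.sqrt (2 * π / d) * j) / Real.sqrt (2 * π * d))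

theorem truncGauss_sq_eq_indicator (Δ ε : ℝ) :
    (fun x => truncGauss Δ ε x ^ 2) =
      (Set.Icc (-ε) ε).indicator (fun x => Real.exp (-x ^ 2 / (2 * Δ ^ 2)) ^ 2) := by
  funext x
  simp only [truncGauss, Set.indicator_apply, Set.mem_Icc, abs_le]
  split_ifs <;> simp

theorem integrable_truncGauss_sq (Δ ε : ℝ) :
    Integrable (fun x => truncGauss Δ ε x ^ 2) := by
  rw [truncGauss_sq_eq_indicator, integrable_indicator_iff measurableSet_Icc]
  exact Continuous.integrableOn_Icc (by fun_prop)

theorem integral_truncGauss_sq_pos (Δ : ℝ) {ε : ℝ} (hε : 0 < ε) :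
    0 < ∫ x : ℝ, truncGauss Δ ε x ^ 2 := by
  rw [integral_pos_iff_support_of_nonneg (fun x => sq_nonneg _) (integrable_truncGauss_sq Δ ε)]
  refine lt_of_lt_of_le (b := volume (Set.Icc (-ε) ε)) ?_ (measure_mono ?_)
  · rw [Real.volume_Icc, ENNReal.ofReal_pos]
    linarith
  · intro x hx
    have hx' : |x| ≤ ε := abs_le.2 hx
    simp [truncGauss, hx', Real.exp_ne_zero]

theorem integrable_truncGaussNorm_sq (Δ ε : ℝ) :
    Integrable (fun x => truncGaussNorm Δ ε x ^ 2) := by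
  simp only [truncGaussNorm, div_pow]
  exact (integrable_truncGauss_sq Δ ε).div_const _

theorem integral_truncGaussNorm_sq (Δ : ℝ) {ε : ℝ} (hε : 0 < ε) :
    ∫ x : ℝ, truncGaussNorm Δ ε x ^ 2 = 1 := by
  have h := integral_truncGauss_sq_pos Δ hε
  simp only [truncGaussNorm, div_pow]
  rw [integral_div, Real.sq_sqrt h.le, div_self h.ne']

theorem truncGaussNorm_eq_zero {Δ ε x : ℝ} (hx : ε < |x|) : truncGaussNorm Δ ε x = 0 := by
  simp [truncGaussNorm, truncGauss, not_le.2 hx]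

/-- Translates of the truncated Gaussian by at least `2ε` overlap in at most one point. -/
theorem truncGaussNorm_mul_ae_eq_zero (Δ : ℝ) {ε a b : ℝ} (hab : 2 * ε ≤ |a - b|) :
    (fun x => truncGaussNorm Δ ε (x - a) * truncGaussNorm Δ ε (x - b)) =ᵐ[volume] 0 := by
  filter_upwards [Measure.ae_ne volume ((a + b) / 2)] with x hx
  by_cases ha : ε < |x - a|
  · simp [truncGaussNorm_eq_zero ha]
  by_cases hb : ε < |x - b|
  · simp [truncGaussNorm_eq_zero hb]
  exfalso
  apply hx
  rw [not_lt, abs_le] at ha hb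
  rcases le_abs'.1 hab with h | h <;> linarith [ha.1, ha.2, hb.1, hb.2]

theorem integrable_truncGaussNorm_mul (Δ : ℝ) {ε a b : ℝ} (hab : a = b ∨ 2 * ε ≤ |a - b|) :
    Integrable (fun x => truncGaussNorm Δ ε (x - a) * truncGaussNorm Δ ε (x - b)) := by
  rcases hab with rfl | hab
  · simp only [← pow_two]
    exact (integrable_truncGaussNorm_sq Δ ε).comp_sub_right a
  · exact (integrable_zero ℝ ℝ volume).congr (truncGaussNorm_mul_ae_eq_zero Δ hab).symm

theorem integral_truncGaussNorm_mul (Δ : ℝ) {ε a b : ℝ} (hε : 0 < ε)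
    (hab : a = b ∨ 2 * ε ≤ |a - b|) :
    ∫ x : ℝ, truncGaussNorm Δ ε (x - a) * truncGaussNorm Δ ε (x - b) =
      if a = b then 1 else 0 := by
  rcases hab with rfl | hab
  · simp only [← pow_two, if_true]
    rw [integral_sub_right_eq_self (fun x => truncGaussNorm Δ ε x ^ 2) a,
      integral_truncGaussNorm_sq Δ hε]
  · have hne : a ≠ b := by
      rintro rfl
      simp only [sub_self, abs_zero] at hab
      linarith
    rw [if_neg hne, integral_congr_ae (truncGaussNorm_mul_ae_eq_zero Δ hab)]
    simp

/-- The points `j / d + z` with `0 ≤ j < d` and `z` an integer determine `j` and `z`. -/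
theorem div_add_int_eq_iff {d j k : ℕ} (hj : j < d) (hk : k < d) (z w : ℤ) :
    (j / d + z : ℝ) = k / d + w ↔ j = k ∧ z = w := by
  have hd : (d : ℝ) ≠ 0 := by
    exact_mod_cast (by omega : d ≠ 0)
  refine ⟨fun h => ?_, by rintro ⟨rfl, rfl⟩; rfl⟩
  field_simp at h
  have h' : (j : ℤ) + d * z = k + d * w := by exact_mod_cast h
  have hm := congrArg (· % (d : ℤ)) h'
  simp only [Int.add_mul_emod_self_left] at hm
  rw [Int.emod_eq_of_lt (by omega) (by omega), Int.emod_eq_of_lt (by omega) (by omega)] at hm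
  refine ⟨by omega, ?_⟩
  rw [hm] at h'
  exact mul_left_cancel₀ (by omega : (d : ℤ) ≠ 0) (by linarith)

/-- Distinct points of `(1 / d) ℤ` are at distance at least `1 / d`. -/
theorem div_add_int_eq_or_le_abs_sub {d : ℕ} (hd : 0 < d) {ε : ℝ} (hε : ε ≤ 1 / (2 * d))
    (j k : ℕ) (z w : ℤ) :
    (j / d + z : ℝ) = k / d + w ∨ 2 * ε ≤ |(j / d + z : ℝ) - (k / d + w)| := by
  have hd' : (0 : ℝ) < d := by exact_mod_cast hd
  have key : (j / d + z : ℝ) - (k / d + w) = ((j - k + d * (z - w) : ℤ) : ℝ) / d := by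
    push_cast
    field_simp
    ring
  by_cases hn : (j - k + d * (z - w) : ℤ) = 0
  · left
    rw [hn] at key
    simpa [sub_eq_zero] using key
  · right
    rw [key, abs_div, abs_of_pos hd', le_div_iff₀ hd']
    have h1 : (1 : ℝ) ≤ |((j - k + d * (z - w) : ℤ) : ℝ)| := by
      exact_mod_cast Int.one_le_abs hn
    rw [le_div_iff₀ (by positivity)] at hε
    linarith

theorem integral_shaState_sub_mul {d j k L : ℕ} (Δ : ℝ) {ε : ℝ} (hL : 2 ≤ L) (hLeven : Even L)
    (hε : 0 < ε) (hε' : ε ≤ 1 / (2 * d)) (hj : j < d) (hk : k < d) :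
    ∫ y : ℝ, shaState L Δ ε (y - j / d) * shaState L Δ ε (y - k / d) =
      if j = k then 1 else 0 := by
  have hsep := div_add_int_eq_or_le_abs_sub (by omega : 0 < d) hε' j k
  have hcard : ((Finset.Icc (-(L : ℤ) / 2) ((L : ℤ) / 2 - 1)).card : ℝ) = L := by
    obtain ⟨m, rfl⟩ := hLeven
    rw [Int.card_Icc]
    have hc : (m + m : ℤ) / 2 - 1 + 1 - -(m + m : ℤ) / 2 = ((m + m : ℕ) : ℤ) := by
      push_cast
      omega
    push_cast at hc ⊢
    rw [hc]
    norm_cast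
  have hL0 : (L : ℝ) ≠ 0 := by exact_mod_cast (by omega : L ≠ 0)
  have hsqrt : (√(L : ℝ))⁻¹ * (√(L : ℝ))⁻¹ = (L : ℝ)⁻¹ := by
    rw [← mul_inv, Real.mul_self_sqrt (Nat.cast_nonneg L)]
  simp only [shaState, sub_sub, mul_mul_mul_comm, hsqrt, Finset.sum_mul_sum]
  rw [integral_const_mul, integral_finsetSum _ fun z _ => integrable_finsetSum _ fun w _ =>
    integrable_truncGaussNorm_mul Δ (hsep z w)]
  simp_rw [integral_finsetSum _ fun w _ => integrable_truncGaussNorm_mul Δ (hsep _ w),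
    integral_truncGaussNorm_mul Δ hε (hsep _ _), div_add_int_eq_iff hj hk]
  by_cases hjk : j = k
  · have hsum : ∀ z ∈ Finset.Icc (-(L : ℤ) / 2) ((L : ℤ) / 2 - 1),
        (∑ w ∈ Finset.Icc (-(L : ℤ) / 2) ((L : ℤ) / 2 - 1), if z = w then (1 : ℝ) else 0) = 1 :=
      fun z hz => by rw [Finset.sum_ite_eq, if_pos hz]
    simp only [hjk, true_and, if_true]
    rw [Finset.sum_congr rfl hsum, Finset.sum_const, nsmul_eq_mul, mul_one, hcard,
      inv_mul_cancel₀ hL0]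
  · simp [hjk]

/-- The rectangular-envelope GKP code states `Sha^ε_{L,Δ}(0)_d,…,Sha^ε_{L,Δ}(d−1)_d`
form an orthonormal family in `L²(ℝ)` whenever `ε ∈ (0, 1/(2d)]`. -/
theorem shaCode_orthonormal (d : ℕ) (hd : 2 ≤ d) (Δ : ℝ) (hΔ : 0 < Δ)
    (L : ℕ) (hL : 2 ≤ L) (hLeven : Even L)
    (ε : ℝ) (hε : 0 < ε) (hε' : ε ≤ 1 / (2 * d))
    (j k : ℕ) (hj : j < d) (hk : k < d) :
    ∫ x : ℝ, shaCode d L Δ ε j x * shaCode d L Δ ε k x =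
      if j = k then 1 else 0 := by
  have hd0 : (0 : ℝ) < d := by exact_mod_cast (by omega : 0 < d)
  have hs : (0 : ℝ) < 2 * π * d := by positivity
  have hratio : √(2 * π / d) = √(2 * π * d) / d := by
    rw [eq_div_iff hd0.ne', ← Real.sqrt_sq hd0.le, ← Real.sqrt_mul (by positivity),
      Real.sqrt_sq hd0.le]
    congr 1
    field_simp
  have hsqrt : 0 < √(2 * π * d) := Real.sqrt_pos.2 hs
  have harg : ∀ (i : ℕ) (x : ℝ),
      (x - √(2 * π / d) * i) / √(2 * π * d) = x / √(2 * π * d) - i / d := by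
    intro i x
    rw [hratio]
    field_simp
  have hconst : ((2 * π * d : ℝ) ^ (-(1 / 4 : ℝ))) * (2 * π * d) ^ (-(1 / 4 : ℝ)) *
      √(2 * π * d) = 1 := by
    rw [Real.sqrt_eq_rpow, ← Real.rpow_add hs, ← Real.rpow_add hs]
    norm_num
  simp only [shaCode, harg, mul_mul_mul_comm]
  rw [integral_const_mul, Measure.integral_comp_div
      (fun y => shaState L Δ ε (y - j / d) * shaState L Δ ε (y - k / d)),
    integral_shaState_sub_mul Δ hL hLeven hε hε' hj hk, abs_of_pos hsqrt, smul_eq_mul,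
    ← mul_assoc, hconst, one_mul]
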